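/- (Abstract Kastanas Theorem.) Let (ℛ,≤,r) be a selective topological Ramsey space. Then, for every 𝒳 ⊆ ℛ, the following are equivalent: (a) 𝒳 is Ramsey; (b) for every nonempty basic open set [a,A], the abstract Kastanas game 𝒢_{[a,A]}(𝒳) is determined. -/

import Mathlib

open scoped Topology

namespace AbstractTRS

/-- A combinatorial structure `(ℛ, ≤, r)`: a quasi-ordered set `R` of objects together with
approximation mappings `r : R → ℕ → α` and a finitization relation `≤_fin` on approximations. -/
structure CombStruct (R : Type) (α : Type) where
  le : R → R → Prop
  le_refl : ∀ A, le A A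
  le_trans : ∀ {A B C}, le A B → le B C → le A C
  r : R → ℕ → α
  lefin : α → α → Prop

namespace CombStruct

variable {R α : Type} (S : CombStruct R α)

/-- `𝒜ℛ`, the set of all finite approximations. -/
def AR : Set α := {a | ∃ (A : R) (n : ℕ), S.r A n = a}

/-- `𝒜ℛ_n`, the set of all `n`-approximations. -/
def ARn (n : ℕ) : Set α := {a | ∃ A : R, S.r A n = a}

/-- `a ⊑ b` : `a` is an initial segment of `b`. -/
def Init (a b : α) : Prop := ∃ (C : R) (n m : ℕ), n ≤ m ∧ S.r C n = a ∧ S.r C m = b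

/-- `a ⊏ b` : `a` is a proper initial segment of `b`. -/
def PInit (a b : α) : Prop := S.Init a b ∧ a ≠ b

/-- The basic set `[a, B]`, where `na = |a|` is the length of `a`. -/
def seg (a : α) (na : ℕ) (B : R) : Set R := {X | S.le X B ∧ S.r X na = a}

/-- `[n, B] = [r_n(B), B]`. -/
def segN (n : ℕ) (B : R) : Set R := S.seg (S.r B n) n B

/-- `depth_B(a) < ∞`. -/
def hasDepth (B : R) (a : α) : Prop := ∃ n, S.lefin a (S.r B n)

/-- `depth_B(a)` : the minimal `n` with `a ≤_fin r_n(B)` (junk value `0` if there is none). -/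
noncomputable def depth (B : R) (a : α) : ℕ :=
  letI : DecidablePred fun n => S.lefin a (S.r B n) := Classical.decPred _
  letI : Decidable (∃ n, S.lefin a (S.r B n)) := Classical.dec _
  if h : ∃ n, S.lefin a (S.r B n) then Nat.find h else 0

/-- `r_n''[a,B]`, where `na = |a|`. -/
def rimg (n : ℕ) (a : α) (na : ℕ) (B : R) : Set α :=
  {d | ∃ D ∈ S.seg a na B, S.r D n = d}

/-- Axioms A.1 (metrization). -/
def A1 : Prop :=
  (∀ A B : R, S.r A 0 = S.r B 0) ∧
  (∀ A B : R, A ≠ B → ∃ n, S.r A n ≠ S.r B n) ∧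
  (∀ (A B : R) (n m : ℕ), S.r A n = S.r B m → n = m ∧ ∀ k ≤ n, S.r A k = S.r B k)

/-- Axioms A.2 (finitization): `≤_fin` is a quasi-order on `𝒜ℛ` satisfying A.2.1–A.2.3. -/
def A2 : Prop :=
  (∀ a ∈ S.AR, S.lefin a a) ∧
  (∀ a b c : α, S.lefin a b → S.lefin b c → S.lefin a c) ∧
  (∀ b : α, {a : α | S.lefin a b}.Finite) ∧
  (∀ A B : R, S.le A B ↔ ∀ n : ℕ, ∃ m : ℕ, S.lefin (S.r A n) (S.r B m)) ∧
  (∀ a b c : α, S.Init a b → S.lefin b c → ∃ d : α, S.Init d c ∧ S.lefin a d)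

/-- Axioms A.3 (amalgamation). -/
def A3 : Prop :=
  (∀ (a : α) (na : ℕ), a ∈ S.ARn na → ∀ B : R, S.hasDepth B a →
    ∀ A ∈ S.segN (S.depth B a) B, (S.seg a na A).Nonempty) ∧
  (∀ (a : α) (na : ℕ), a ∈ S.ARn na → ∀ A B : R, S.le A B →
    S.hasDepth B a → S.hasDepth A a → S.depth A a ≤ S.depth B a →
    ∃ A' ∈ S.segN (S.depth B a) B, S.seg a na A' ⊆ S.seg a na A)

/-- Axiom A.4 (abstract pigeonhole principle). -/
def A4 : Prop :=
  ∀ (a : α) (na : ℕ), a ∈ S.ARn na → ∀ B : R, S.hasDepth B a →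
    ∀ O : Set α, O ⊆ S.ARn (na + 1) →
      ∃ A ∈ S.segN (S.depth B a) B,
        S.rimg (na + 1) a na A ⊆ O ∨ O ∩ S.rimg (na + 1) a na A = ∅

/-- `⟨b,B⟩_m^A = {X ∈ [b,B] : depth_A(r_{|b|+1}(X)) > m}`, where `nb = |b|`. -/
def angle (b : α) (nb : ℕ) (B A : R) (m : ℕ) : Set R :=
  {X | X ∈ S.seg b nb B ∧ (S.hasDepth A (S.r X (nb + 1)) → m < S.depth A (S.r X (nb + 1)))}

/-- Axiom A.3*.1 (first axiom of strong amalgamation). -/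
def A3star1 : Prop :=
  ∀ (b : α) (nb : ℕ), b ∈ S.ARn nb → ∀ (A : R) (m : ℕ),
    S.hasDepth A b → S.depth A b ≤ m →
    ∀ B ∈ S.segN m A, (S.angle b nb B A m).Nonempty

/-- Axiom A.3*.2 (second axiom of strong amalgamation). -/
def A3star2 : Prop :=
  ∀ (b : α) (nb : ℕ), b ∈ S.ARn nb → ∀ (A B : R) (m : ℕ), S.le B A →
    S.hasDepth A b → S.depth A b ≤ m → S.hasDepth B b → S.depth B b ≤ S.depth A b →
    ∃ B' ∈ S.segN m A, S.angle b nb B' A m ⊆ S.angle b nb B A m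

/-- Axioms A.3* (strong amalgamation). -/
def A3star : Prop := S.A3star1 ∧ S.A3star2

/-- The structure is metrically closed: `ℛ`, identified with the set of sequences
`(r_n(A))_n`, is closed in `α^ℕ` with `α` discrete. -/
def MetricallyClosed : Prop :=
  @IsClosed (ℕ → α) (@Pi.topologicalSpace ℕ (fun _ => α) (fun _ => ⊥))
    {f | ∃ A : R, ∀ n, f n = S.r A n}

/-- The basic (open) sets `[a,B]` of the Ellentuck topology. -/
def IsBasic (U : Set R) : Prop :=
  ∃ (a : α) (na : ℕ) (B : R), a ∈ S.ARn na ∧ U = S.seg a na B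

/-- The Ellentuck topology on `ℛ`, generated by the basic sets `[a,B]`. -/
def ellentuck : TopologicalSpace R :=
  TopologicalSpace.generateFrom {U | S.IsBasic U}

/-- `(ℛ,≤,r)` is a topological Ramsey space. -/
def IsTRS : Prop := S.MetricallyClosed ∧ S.A1 ∧ S.A2 ∧ S.A3 ∧ S.A4

/-- `(ℛ,≤,r)` is a strong topological Ramsey space. -/
def IsStrongTRS : Prop := S.MetricallyClosed ∧ S.A1 ∧ S.A2 ∧ S.A3star ∧ S.A4

/-- `𝒳 ⊆ ℛ` is Ramsey. -/
def RamseySet (X : Set R) : Prop :=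
  ∀ (a : α) (na : ℕ) (A : R), a ∈ S.ARn na → (S.seg a na A).Nonempty →
    ∃ B ∈ S.seg a na A, S.seg a na B ⊆ X ∨ S.seg a na B ∩ X = ∅

/-- `𝒳 ⊆ ℛ` is Ramsey null. -/
def RamseyNull (X : Set R) : Prop :=
  ∀ (a : α) (na : ℕ) (A : R), a ∈ S.ARn na → (S.seg a na A).Nonempty →
    ∃ B ∈ S.seg a na A, S.seg a na B ∩ X = ∅

/-- `𝒳` is nowhere dense (with respect to the basis of the Ellentuck topology). -/
def NwdB (X : Set R) : Prop :=
  ∀ U : Set R, S.IsBasic U → U.Nonempty →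
    ∃ V : Set R, S.IsBasic V ∧ V.Nonempty ∧ V ⊆ U ∧ V ∩ X = ∅

/-- `𝒳` is meager: a countable union of nowhere dense sets. -/
def MeagerB (X : Set R) : Prop :=
  ∃ f : ℕ → Set R, (∀ i, S.NwdB (f i)) ∧ X = ⋃ i, f i

/-- `𝒳` has the abstract Baire property. -/
def ABP (X : Set R) : Prop :=
  ∀ U : Set R, S.IsBasic U → U.Nonempty →
    ∃ V : Set R, S.IsBasic V ∧ V.Nonempty ∧ V ⊆ U ∧ (V ⊆ X ∨ V ∩ X = ∅)

/-- `𝒳` has the Baire property: `𝒳 △ 𝒪` is meager for some open set `𝒪`. -/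
def BP (X : Set R) : Prop :=
  ∃ O : Set R, IsOpen[S.ellentuck] O ∧ S.MeagerB (symmDiff X O)

/-- `ℛ ↾ H = {A ∈ ℛ : A ≤ H}`. -/
def restrict (H : R) : Set R := {A | S.le A H}

/-- `𝒮_b^𝒬 = {D ∈ ℛ : ∅ ≠ [b,D] ⊆ 𝒬}`, where `nb = |b|`. -/
def Sb (Q : Set R) (b : α) (nb : ℕ) : Set R :=
  {D | (S.seg b nb D).Nonempty ∧ S.seg b nb D ⊆ Q}

/-- `D∞` is a diagonalization of the sequence `{D_n}` inside `[a,B]`: for every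
`b ∈ 𝒜ℛ↾[a,D∞]` (with `|b| = nb`) one has `∅ ≠ [b,D∞] ⊆ [b,D_{n_b}]`,
where `n_b = depth_B(b) - depth_B(a)`. -/
def Diag (a : α) (B : R) (D : ℕ → R) (Dinf : R) : Prop :=
  ∀ (b : α) (nb : ℕ), b ∈ S.ARn nb → S.Init a b → S.hasDepth Dinf b →
    (S.seg b nb Dinf).Nonempty ∧
    S.seg b nb Dinf ⊆ S.seg b nb (D (S.depth B b - S.depth B a))

/-- The space is selective: decreasing sequences inside nonempty basic sets admit
diagonalizations. -/
def Selective : Prop :=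
  ∀ (a : α) (na : ℕ) (B : R), a ∈ S.ARn na → (S.seg a na B).Nonempty →
    ∀ D : ℕ → R, (∀ n, D n ∈ S.seg a na B) → (∀ n, S.le (D (n + 1)) (D n)) →
      ∃ Dinf ∈ S.seg a na B, S.Diag a B D Dinf

/-! ### The abstract Kastanas game `𝒢_{[a₀,B₀]}(𝒳)`

Player I plays objects `A 0, A 1, A 2, …` (the paper's `A₁, A₂, …`) and player II answers
with basic sets `[ak (k+1), Bk (k+1)]` (the paper's `[a₁,B₁], [a₂,B₂], …`), where
`ak 0 = a₀` and `Bk 0 = B₀`; `na = |a₀|`, so `|ak k| = na + k`. -/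

/-- The moves of player I induced by a strategy `σ` (which sees II's previous moves). -/
def playI (σ : List (α × R) → R) (ak : ℕ → α) (Bk : ℕ → R) (k : ℕ) : R :=
  σ (List.ofFn fun i : Fin k => (ak (i.1 + 1), Bk (i.1 + 1)))

/-- Rule for player I's k-th move: `A_{k+1} ∈ [a_k, B_k]`. -/
def ruleI (na : ℕ) (ak : ℕ → α) (Bk : ℕ → R) (A : ℕ → R) (k : ℕ) : Prop :=
  A k ∈ S.seg (ak k) (na + k) (Bk k)

/-- Rule for player II's k-th move: `a_k ⊏ a_{k+1}`, `|a_{k+1}| = |a_k| + 1` and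
`B_{k+1} ∈ [a_{k+1}, A_{k+1}]`. -/
def ruleII (na : ℕ) (ak : ℕ → α) (Bk : ℕ → R) (A : ℕ → R) (k : ℕ) : Prop :=
  (∃ C : R, S.r C (na + k) = ak k ∧ S.r C (na + k + 1) = ak (k + 1)) ∧
  ak k ≠ ak (k + 1) ∧
  Bk (k + 1) ∈ S.seg (ak (k + 1)) (na + k + 1) (A k)

/-- The outcome `B∞`, determined by `{B∞} = ⋂ₖ [a_k]`, belongs to `X`. -/
def limitMem (na : ℕ) (ak : ℕ → α) (X : Set R) : Prop :=
  ∀ Binf : R, ({Binf} : Set R) = ⋂ k : ℕ, {Y : R | S.r Y (na + k) = ak k} → Binf ∈ X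

/-- `σ` is a winning strategy for player I in `𝒢_{[a,B₀]}(𝒳)`: it plays legally at every
legal position consistent with it, and every legal play following it is won by player I. -/
def IWinning (X : Set R) (a : α) (na : ℕ) (B0 : R) (σ : List (α × R) → R) : Prop :=
  (∀ (ak : ℕ → α) (Bk : ℕ → R), ak 0 = a → Bk 0 = B0 → ∀ k : ℕ,
      (∀ i < k, S.ruleII na ak Bk (playI σ ak Bk) i) →
      S.ruleI na ak Bk (playI σ ak Bk) k) ∧
  (∀ (ak : ℕ → α) (Bk : ℕ → R), ak 0 = a → Bk 0 = B0 →
      (∀ k : ℕ, S.ruleI na ak Bk (playI σ ak Bk) k ∧ S.ruleII na ak Bk (playI σ ak Bk) k) →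
      S.limitMem na ak X)

/-- First components of player II's moves induced by a strategy `τ`. -/
def playIIa (a : α) (τ : List R → α × R) (A : ℕ → R) : ℕ → α
  | 0 => a
  | k + 1 => (τ (List.ofFn fun i : Fin (k + 1) => A i.1)).1

/-- Second components of player II's moves induced by a strategy `τ`. -/
def playIIB (B0 : R) (τ : List R → α × R) (A : ℕ → R) : ℕ → R
  | 0 => B0
  | k + 1 => (τ (List.ofFn fun i : Fin (k + 1) => A i.1)).2

/-- `τ` is a winning strategy for player II in `𝒢_{[a,B₀]}(𝒳)`: it plays legally at every
legal position consistent with it, and every legal play following it is won by player II. -/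
def IIWinning (X : Set R) (a : α) (na : ℕ) (B0 : R) (τ : List R → α × R) : Prop :=
  (∀ (A : ℕ → R) (k : ℕ),
      (∀ i ≤ k, S.ruleI na (playIIa a τ A) (playIIB B0 τ A) A i) →
      (∀ i < k, S.ruleII na (playIIa a τ A) (playIIB B0 τ A) A i) →
      S.ruleII na (playIIa a τ A) (playIIB B0 τ A) A k) ∧
  (∀ A : ℕ → R,
      (∀ k : ℕ, S.ruleI na (playIIa a τ A) (playIIB B0 τ A) A k ∧
        S.ruleII na (playIIa a τ A) (playIIB B0 τ A) A k) →
      ∀ Binf : R,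
        ({Binf} : Set R) = ⋂ k : ℕ, {Y : R | S.r Y (na + k) = playIIa a τ A k} →
        Binf ∉ X)

section Auxiliary

variable {S}

theorem depth_spec {B : R} {a : α} (h : S.hasDepth B a) : S.lefin a (S.r B (S.depth B a)) := by
  classical
  have h' : ∃ n, S.lefin a (S.r B n) := h
  unfold depth
  rw [dif_pos h']
  exact @Nat.find_spec _ (_) h'

theorem depth_le {B : R} {a : α} {n : ℕ} (h : S.lefin a (S.r B n)) : S.depth B a ≤ n := by
  classical
  have h' : ∃ n, S.lefin a (S.r B n) := ⟨n, h⟩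
  unfold depth
  rw [dif_pos h']
  exact @Nat.find_min' _ (_) h' _ h

theorem A2.hasDepth (h : S.A2) {Y B : R} (hY : S.le Y B) (n : ℕ) : S.hasDepth B (S.r Y n) :=
  (h.2.2.2.1 Y B).1 hY n

/-- Depth is monotone along initial segments. -/
theorem depth_mono (h1 : S.A1) (h2 : S.A2) {Y B : R} (hY : S.le Y B) {n m : ℕ} (hnm : n ≤ m) :
    S.depth B (S.r Y n) ≤ S.depth B (S.r Y m) := by
  have hm := depth_spec (h2.hasDepth hY m)
  obtain ⟨d, ⟨C, i, j, hij, hi, hj⟩, hd⟩ :=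
    h2.2.2.2.2 _ _ _ ⟨Y, n, m, hnm, rfl, rfl⟩ hm
  obtain ⟨hjd, hk⟩ := h1.2.2 _ _ _ _ hj
  rw [← hi, hk i hij] at hd
  exact (depth_le hd).trans (hij.trans hjd.le)

theorem A1.r_eq_of_le (h : S.A1) {Y Z : R} {n m : ℕ} (e : S.r Y m = S.r Z m) (hnm : n ≤ m) :
    S.r Y n = S.r Z n :=
  (h.2.2 _ _ _ _ e).2 n hnm

theorem A1.iInter_eq_singleton (h : S.A1) (Y : R) (na : ℕ) :
    ({Y} : Set R) = ⋂ k : ℕ, {Z : R | S.r Z (na + k) = S.r Y (na + k)} := by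
  ext Z
  simp only [Set.mem_singleton_iff, Set.mem_iInter, Set.mem_ofPred_eq]
  refine ⟨fun e k => by rw [e], fun hZ => ?_⟩
  by_contra hne
  obtain ⟨n, hn⟩ := h.2.1 Z Y hne
  exact hn (h.r_eq_of_le (hZ n) (Nat.le_add_left n na))

open Classical in
/-- The length of a finite approximation. -/
noncomputable def len (S : CombStruct R α) (c : α) : ℕ :=
  if h : ∃ n, c ∈ S.ARn n then h.choose else 0

theorem A1.len_r (h : S.A1) (Y : R) (n : ℕ) : S.len (S.r Y n) = n := by
  have hex : ∃ m, S.r Y n ∈ S.ARn m := ⟨n, Y, rfl⟩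
  unfold len
  rw [dif_pos hex]
  obtain ⟨C, hC⟩ := hex.choose_spec
  exact (h.2.2 _ _ _ _ hC).1

open Classical in
/-- The immediate predecessor of a finite approximation of positive length. -/
noncomputable def par (S : CombStruct R α) (c : α) : α :=
  if h : ∃ x : R × ℕ, S.r x.1 (x.2 + 1) = c then S.r h.choose.1 h.choose.2 else c

theorem A1.par_r (h : S.A1) (Y : R) (n : ℕ) : S.par (S.r Y (n + 1)) = S.r Y n := by
  have hex : ∃ x : R × ℕ, S.r x.1 (x.2 + 1) = S.r Y (n + 1) := ⟨(Y, n), rfl⟩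
  unfold par
  rw [dif_pos hex]
  obtain ⟨e, hk⟩ := h.2.2 _ _ _ _ hex.choose_spec
  rw [hk _ (Nat.le_succ _)]
  congr 1
  omega

/-- `c` is a proper end-extension of `a` realised by some object below `D`. -/
def Active (S : CombStruct R α) (a : α) (na : ℕ) (D : R) (c : α) : Prop :=
  ∃ Y ∈ S.seg a na D, ∃ n, na ≤ n ∧ S.r Y (n + 1) = c

/-- `q` is a label for the node `c`, good relative to the label `p` of its predecessor and
whose target dominates `[c, D]`, or else no good label has its target in `[c, D]`. -/
def Settled (S : CombStruct R α) {P : Type} (Good : P → α → P → Prop) (T : P → R)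
    (p : P) (c : α) (q : P) (D : R) : Prop :=
  (Good p c q ∧ ∀ Z ∈ S.seg c (S.len c) D, S.le Z (T q)) ∨
    ∀ q', Good p c q' → T q' ∉ S.seg c (S.len c) D

theorem Settled.mono {P : Type} {Good : P → α → P → Prop} {T : P → R} {p q : P} {c : α}
    {D D' : R} (h : S.Settled Good T p c q D)
    (hD : S.seg c (S.len c) D' ⊆ S.seg c (S.len c) D) : S.Settled Good T p c q D' :=
  h.imp (fun h => ⟨h.1, fun Z hZ => h.2 Z (hD hZ)⟩) fun h q' hq' hT => h q' hq' (hD hT)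

theorem seg_mono {D D' : R} (h : S.le D' D) (c : α) (n : ℕ) : S.seg c n D' ⊆ S.seg c n D :=
  fun _ hZ => ⟨S.le_trans hZ.1 h, hZ.2⟩

theorem Active.mono {a c : α} {na : ℕ} {D D' : R} (h : S.Active a na D' c) (hD : S.le D' D) :
    S.Active a na D c := by
  obtain ⟨Y, hY, hn⟩ := h
  exact ⟨Y, seg_mono hD _ _ hY, hn⟩

/-- Finitely many nodes can be settled by shrinking the object and relabelling them. -/
theorem exists_settled_finset (h1 : S.A1) {P : Type} (Good : P → α → P → Prop) (T : P → R)
    (a : α) (na : ℕ) (F : Finset α) (D : R) (hD : S.r D na = a) (f : α → P) :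
    ∃ D' ∈ S.seg a na D, ∃ f' : α → P, (∀ c ∉ F, f' c = f c) ∧
      ∀ c ∈ F, S.Active a na D' c → S.Settled Good T (f' (S.par c)) c (f' c) D' := by
  classical
  induction F using Finset.induction_on_max_value S.len with
  | empty => exact ⟨D, ⟨S.le_refl D, hD⟩, f, fun _ _ => rfl, by simp⟩
  | insert c F hcF hmax ih =>
    obtain ⟨D₁, hD₁, f₁, hf₁, hs⟩ := ih
    by_cases hex : S.Active a na D₁ c ∧
        ∃ q, Good (f₁ (S.par c)) c q ∧ T q ∈ S.seg c (S.len c) D₁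
    · obtain ⟨⟨Y, hY, n, hn, rfl⟩, q, hq, hT⟩ := hex
      have hTa : S.r (T q) na = a := by
        have e := hT.2
        rw [h1.len_r] at e
        rw [h1.r_eq_of_le e (hn.trans (Nat.le_succ n)), hY.2]
      have key : ∀ x : α, S.len x < n + 1 →
          Function.update f₁ (S.r Y (n + 1)) q x = f₁ x := by
        intro x hx
        refine Function.update_of_ne ?_ _ _
        rintro rfl
        rw [h1.len_r] at hx
        exact lt_irrefl _ hx
      refine ⟨T q, ⟨S.le_trans hT.1 hD₁.1, hTa⟩, Function.update f₁ (S.r Y (n + 1)) q, ?_, ?_⟩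
      · intro x hx
        rw [Finset.mem_insert, not_or] at hx
        rw [Function.update_of_ne hx.1, hf₁ x hx.2]
      · intro x hx hact
        rcases Finset.mem_insert.1 hx with rfl | hxF
        · rw [h1.par_r, key _ (by rw [h1.len_r]; omega), Function.update_self]
          rw [h1.par_r] at hq
          exact Or.inl ⟨hq, fun Z hZ => hZ.1⟩
        · have hx' := hs x hxF (hact.mono hT.1)
          have hlen := hmax x hxF
          obtain ⟨Z, -, m, -, rfl⟩ := hact
          have hne : S.r Z (m + 1) ≠ S.r Y (n + 1) := fun e => hcF (e ▸ hxF)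
          rw [h1.len_r, h1.len_r] at hlen
          rw [Function.update_of_ne hne, h1.par_r, key _ (by rw [h1.len_r]; omega)]
          rw [h1.par_r] at hx'
          exact hx'.mono (seg_mono hT.1 _ _)
    · refine ⟨D₁, hD₁, f₁, fun x hx => hf₁ x fun h => hx (Finset.mem_insert_of_mem h), ?_⟩
      intro x hx hact
      rcases Finset.mem_insert.1 hx with rfl | hxF
      · exact Or.inr fun q' hq' hT => hex ⟨hact, q', hq', hT⟩
      · exact hs x hxF hact

theorem A2.finite_depth_eq (h2 : S.A2) (B : R) (d n : ℕ) :
    {c : α | S.hasDepth B c ∧ S.depth B c - d = n}.Finite := by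
  have hfin : (⋃ m ∈ Set.Iic (n + d), {c : α | S.lefin c (S.r B m)}).Finite :=
    (Set.finite_Iic (n + d)).biUnion fun m _ => h2.2.2.1 _
  refine hfin.subset fun c hc => ?_
  simp only [Set.mem_iUnion]
  exact ⟨S.depth B c, by have := hc.2; simp only [Set.mem_Iic]; omega, depth_spec hc.1⟩

/-- Fusion: in a selective space all nodes extending `a` can be settled by one object. -/
theorem exists_settled (h1 : S.A1) (h2 : S.A2) (hSel : S.Selective) {P : Type}
    (Good : P → α → P → Prop) (T : P → R) (p₀ : P) (a : α) (na : ℕ) (B : R)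
    (hB : S.r B na = a) :
    ∃ D ∈ S.seg a na B, ∃ f : α → P, f a = p₀ ∧ ∀ Y ∈ S.seg a na D, ∀ k,
      S.Settled Good T (f (S.r Y (na + k))) (S.r Y (na + k + 1)) (f (S.r Y (na + k + 1))) D := by
  classical
  have hfin : ∀ n, {c : α | S.Active a na B c ∧ S.depth B c - S.depth B a = n}.Finite :=
    fun n => (h2.finite_depth_eq B (S.depth B a) n).subset fun c hc => by
      refine ⟨?_, hc.2⟩
      obtain ⟨⟨Y, hY, m, -, rfl⟩, -⟩ := hc
      exact h2.hasDepth hY.1 _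
  let St := {x : R × (α → P) // S.r x.1 na = a}
  have hnext : ∀ (x : St) (n : ℕ), ∃ y : St, S.le y.1.1 x.1.1 ∧
      (∀ c, ¬ (S.Active a na B c ∧ S.depth B c - S.depth B a = n) → y.1.2 c = x.1.2 c) ∧
      ∀ c, S.Active a na B c → S.depth B c - S.depth B a = n → S.Active a na y.1.1 c →
        S.Settled Good T (y.1.2 (S.par c)) c (y.1.2 c) y.1.1 := by
    rintro ⟨⟨D, f⟩, hD⟩ n
    obtain ⟨D', hD', f', hf', hs⟩ :=
      exists_settled_finset h1 Good T a na (hfin n).toFinset D hD f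
    refine ⟨⟨(D', f'), hD'.2⟩, hD'.1, fun c hc => hf' c (by simpa using hc), ?_⟩
    exact fun c hc hc' hact => hs c (by simpa using ⟨hc, hc'⟩) hact
  choose next hle hoff hset using hnext
  let x₀ : St := ⟨(B, fun _ => p₀), hB⟩
  let st : ℕ → St := fun n => Nat.rec (next x₀ 0) (fun m x => next x (m + 1)) n
  have hst : ∀ n, st (n + 1) = next (st n) (n + 1) := fun n => rfl
  have hleB : ∀ n, S.le (st n).1.1 B := by
    intro n
    induction n with
    | zero => exact hle x₀ 0
    | succ n ih => exact S.le_trans (hle (st n) (n + 1)) ih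
  have hsettled : ∀ n c, S.Active a na B c → S.depth B c - S.depth B a = n →
      S.Active a na (st n).1.1 c →
      S.Settled Good T ((st n).1.2 (S.par c)) c ((st n).1.2 c) (st n).1.1 := by
    intro n
    cases n with
    | zero => exact hset x₀ 0
    | succ n => exact hset (st n) (n + 1)
  have hstable : ∀ c n, S.depth B c - S.depth B a ≤ n →
      (st n).1.2 c = (st (S.depth B c - S.depth B a)).1.2 c := by
    intro c n hn
    induction n, hn using Nat.le_induction with
    | base => rfl
    | succ n hn ih =>
      rw [← ih]
      exact hoff (st n) (n + 1) c fun h => by have := h.2; omega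
  have haAct : ¬ S.Active a na B a := by
    rintro ⟨Y, hY, n, hn, e⟩
    have := (h1.2.2 _ _ _ _ (e.trans hY.2.symm)).1
    omega
  obtain ⟨D, hD, hdiag⟩ := hSel a na B ⟨B, hB⟩ ⟨B, S.le_refl B, hB⟩ (fun n => (st n).1.1)
    (fun n => ⟨hleB n, (st n).2⟩) (fun n => hle (st n) (n + 1))
  refine ⟨D, hD, fun c => (st (S.depth B c - S.depth B a)).1.2 c, ?_, ?_⟩
  · have : S.depth B a - S.depth B a = 0 := Nat.sub_self _
    simp only [this]
    exact hoff x₀ 0 a fun h => haAct h.1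
  · intro Y hY k
    have hYB : S.le Y B := S.le_trans hY.1 hD.1
    have hsub := (hdiag (S.r Y (na + k + 1)) (na + k + 1) ⟨Y, rfl⟩
      ⟨Y, na, na + k + 1, by omega, hY.2, rfl⟩ (h2.hasDepth hY.1 _)).2
    have hYm := hsub ⟨hY.1, rfl⟩
    have hs := hsettled _ (S.r Y (na + k + 1)) ⟨Y, ⟨hYB, hY.2⟩, na + k, by omega, rfl⟩ rfl
      ⟨Y, ⟨hYm.1, hY.2⟩, na + k, by omega, rfl⟩
    rw [h1.par_r, hstable (S.r Y (na + k))] at hs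
    · refine hs.mono ?_
      rw [h1.len_r]
      exact hsub
    · exact Nat.sub_le_sub_right (depth_mono h1 h2 hYB (Nat.le_succ _)) _

/-- `[b, D]` is homogeneous for `O`. -/
def Hom (S : CombStruct R α) (O : Set α) (b : α) (nb : ℕ) (D : R) : Prop :=
  (∀ Z ∈ S.seg b nb D, S.r Z (nb + 1) ∈ O) ∨ ∀ Z ∈ S.seg b nb D, S.r Z (nb + 1) ∉ O

theorem Hom.mono {O : Set α} {b : α} {nb : ℕ} {D D' : R} (h : S.Hom O b nb D)
    (hD : S.seg b nb D' ⊆ S.seg b nb D) : S.Hom O b nb D' :=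
  h.imp (fun h Z hZ => h Z (hD hZ)) fun h Z hZ => h Z (hD hZ)

theorem exists_hom (h2 : S.A2) (h3 : S.A3) (h4 : S.A4) (O : Set α) {b : α} {nb : ℕ} {D : R}
    (hne : (S.seg b nb D).Nonempty) : ∃ D' ∈ S.seg b nb D, S.Hom O b nb D' := by
  obtain ⟨Y, hY⟩ := hne
  have hb : b ∈ S.ARn nb := ⟨Y, hY.2⟩
  have hdep : S.hasDepth D b := by
    rw [← hY.2]
    exact h2.hasDepth hY.1 _
  obtain ⟨A, hA, hAO⟩ := h4 b nb hb D hdep (O ∩ S.ARn (nb + 1)) Set.inter_subset_right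
  obtain ⟨D', hD'⟩ := h3.1 b nb hb D hdep A hA
  refine ⟨D', seg_mono hA.1 _ _ hD', ?_⟩
  have hom : S.Hom O b nb A := by
    refine hAO.imp (fun h Z hZ => (h ⟨Z, hZ, rfl⟩).1) fun h Z hZ hO => ?_
    have : S.r Z (nb + 1) ∈ O ∩ S.ARn (nb + 1) ∩ S.rimg (nb + 1) b nb A :=
      ⟨⟨hO, Z, rfl⟩, Z, hZ, rfl⟩
    rw [h] at this
    exact this
  exact hom.mono (seg_mono hD'.1 _ _)

/-- In a selective space, some object is homogeneous for `O` at every node extending `a`. -/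
theorem exists_forall_hom (hTRS : S.IsTRS) (hSel : S.Selective) (O : Set α) (a : α) (na : ℕ)
    (B : R) (hB : S.r B na = a) :
    ∃ D ∈ S.seg a na B, ∀ Y ∈ S.seg a na D, ∀ k, S.Hom O (S.r Y (na + k)) (na + k) D := by
  obtain ⟨-, h1, h2, h3, h4⟩ := hTRS
  obtain ⟨B', hB', hom⟩ := exists_hom h2 h3 h4 O ⟨B, S.le_refl B, hB⟩
  obtain ⟨D, hD, f, -, hf⟩ := exists_settled h1 h2 hSel
    (fun _ c q => S.Hom O c (S.len c) q) id B' a na B' hB'.2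
  refine ⟨D, ⟨S.le_trans hD.1 hB'.1, hD.2⟩, fun Y hY k => ?_⟩
  cases k with
  | zero =>
    rw [Nat.add_zero, hY.2]
    exact hom.mono (seg_mono hD.1 _ _)
  | succ k =>
    obtain ⟨hg, hT⟩ | hno := hf Y hY k
    · simp only [h1.len_r] at hg hT
      exact hg.mono fun Z hZ => ⟨hT Z hZ, hZ.2⟩
    · exfalso
      simp only [h1.len_r] at hno
      obtain ⟨D', hD', hom'⟩ := exists_hom (D := D) h2 h3 h4 O ⟨Y, hY.1, rfl⟩
      exact hno D' hom' hD'

theorem playI_congr {σ : List (α × R) → R} {ak ak' : ℕ → α} {Bk Bk' : ℕ → R} {k : ℕ}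
    (h : ∀ i < k, ak (i + 1) = ak' (i + 1) ∧ Bk (i + 1) = Bk' (i + 1)) :
    playI σ ak Bk k = playI σ ak' Bk' k := by
  unfold playI
  congr 2
  funext i
  rw [(h i i.2).1, (h i i.2).2]

theorem ofFn_succ_last {β : Type} (g : ℕ → β) (k : ℕ) :
    (List.ofFn fun i : Fin (k + 1) => g i.1) = (List.ofFn fun i : Fin k => g i.1) ++ [g k] := by
  rw [List.ofFn_succ', List.concat_eq_append]
  rfl

/-- If player I has a winning strategy in the game on `[a, A]`, then some `[a, D]` is
contained in `X`. -/
theorem IWinning.exists_subset (h1 : S.A1) (h2 : S.A2) (hSel : S.Selective) {X : Set R}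
    {a : α} {na : ℕ} {A : R} {σ : List (α × R) → R} (hσ : S.IWinning X a na A σ) :
    ∃ D ∈ S.seg a na A, S.seg a na D ⊆ X := by
  have hroot : σ [] ∈ S.seg a na A := hσ.1 (fun _ => a) (fun _ => A) rfl rfl 0 (by simp)
  obtain ⟨D, hD, f, hfa, hf⟩ := exists_settled h1 h2 hSel
    (fun p c q => ∃ B, q = p ++ [(c, B)] ∧ B ∈ S.seg c (S.len c) (σ p)) σ [] a na (σ [])
    hroot.2
  refine ⟨D, ⟨S.le_trans hD.1 hroot.1, hD.2⟩, fun Y hY => ?_⟩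
  let p : ℕ → List (α × R) := fun k => f (S.r Y (na + k))
  let ak : ℕ → α := fun k => S.r Y (na + k)
  let Bk : ℕ → R := fun k => match k with
    | 0 => A
    | k + 1 => ((p (k + 1)).getLastD (a, A)).2
  have hak : ak 0 = a := hY.2
  have key : ∀ k, (p k = List.ofFn fun i : Fin k => (ak (i.1 + 1), Bk (i.1 + 1))) ∧
      S.le Y (σ (p k)) ∧ ∀ i < k, S.ruleII na ak Bk (playI σ ak Bk) i := by
    intro k
    induction k with
    | zero =>
      have hp : p 0 = [] := by
        change f (S.r Y na) = []
        rw [hY.2, hfa]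
      rw [hp]
      exact ⟨by simp, S.le_trans hY.1 hD.1, by simp⟩
    | succ k ih =>
      obtain ⟨hp, hle, hrule⟩ := ih
      have hplay : playI σ ak Bk k = σ (p k) := by rw [hp]; rfl
      have hne : ak k ≠ ak (k + 1) := fun e => by
        have := (h1.2.2 _ _ _ _ e).1
        omega
      have hs := hf Y hY k
      unfold Settled at hs
      rw [h1.len_r] at hs
      obtain ⟨⟨B, hB, hBm⟩, hT⟩ | hno := hs
      · have hB' : p (k + 1) = p k ++ [(ak (k + 1), B)] := hB
        have hBk : Bk (k + 1) = B := by
          change ((p (k + 1)).getLastD (a, A)).2 = B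
          rw [hB']
          simp
        refine ⟨?_, hT Y ⟨hY.1, rfl⟩, fun i hi => ?_⟩
        · rw [ofFn_succ_last fun i => (ak (i + 1), Bk (i + 1)), ← hp, hB', hBk]
        · rcases Nat.lt_succ_iff_lt_or_eq.1 hi with hi | rfl
          · exact hrule i hi
          · refine ⟨⟨Y, rfl, rfl⟩, hne, ?_⟩
            rw [hBk, hplay]
            rw [h1.len_r] at hBm
            exact hBm
      · exfalso
        refine hno (p k ++ [(ak (k + 1), Y)]) ⟨Y, rfl, hle, by rw [h1.len_r]⟩ ?_
        let Bk' := Function.update Bk (k + 1) Y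
        have hoff : ∀ i, i ≤ k → Bk' i = Bk i := fun i hi =>
          Function.update_of_ne (by omega) _ _
        have hon : Bk' (k + 1) = Y := Function.update_self _ _ _
        have hcongr : ∀ i ≤ k, playI σ ak Bk' i = playI σ ak Bk i := fun i hi =>
          playI_congr fun j hj => ⟨rfl, hoff _ (by omega)⟩
        have hlast : playI σ ak Bk' (k + 1) = σ (p k ++ [(ak (k + 1), Y)]) := by
          unfold playI
          rw [ofFn_succ_last fun i => (ak (i + 1), Bk' (i + 1)), hon, hp]
          congr 3
          funext i
          rw [hoff _ i.2]
        have hI := hσ.1 ak Bk' hak (hoff 0 (Nat.zero_le _)) (k + 1) fun i hi => by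
          rcases Nat.lt_succ_iff_lt_or_eq.1 hi with hi | rfl
          · obtain ⟨hc, hn, hm⟩ := hrule i hi
            refine ⟨hc, hn, ?_⟩
            rw [hoff _ hi, hcongr i hi.le]
            exact hm
          · refine ⟨⟨Y, rfl, rfl⟩, hne, ?_⟩
            rw [hon, hcongr i le_rfl, hplay]
            exact ⟨hle, rfl⟩
        unfold ruleI at hI
        rw [hlast, hon] at hI
        exact ⟨S.le_trans hI.1 hY.1, hI.2⟩
  have hII : ∀ k, S.ruleII na ak Bk (playI σ ak Bk) k := fun k =>
    (key (k + 1)).2.2 k (Nat.lt_succ_self k)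
  exact hσ.2 ak Bk hak rfl (fun k => ⟨hσ.1 ak Bk hak rfl k fun i _ => hII i, hII k⟩) Y
    (h1.iInter_eq_singleton Y na)

/-- The last basic set played by player II following `τ` against the moves `p` of player I. -/
def lastII (a : α) (A : R) (τ : List R → α × R) : List R → α × R
  | [] => (a, A)
  | E :: p => τ (E :: p)

theorem lastII_append (a : α) (A : R) (τ : List R → α × R) (p : List R) (E : R) :
    lastII a A τ (p ++ [E]) = τ (p ++ [E]) := by
  cases p <;> rfl

theorem lastII_ofFn (a : α) (A : R) (τ : List R → α × R) (M : ℕ → R) (k : ℕ) :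
    lastII a A τ (List.ofFn fun i : Fin k => M i.1) =
      (playIIa a τ M k, playIIB A τ M k) := by
  cases k with
  | zero => simp [lastII, playIIa, playIIB]
  | succ k =>
    rw [ofFn_succ_last, lastII_append, ← ofFn_succ_last]
    rfl

theorem play_congr {a : α} {A : R} {τ : List R → α × R} {M M' : ℕ → R} {k : ℕ}
    (h : ∀ i < k, M i = M' i) :
    playIIa a τ M k = playIIa a τ M' k ∧ playIIB A τ M k = playIIB A τ M' k := by
  have e : (List.ofFn fun i : Fin k => M i.1) = List.ofFn fun i : Fin k => M' i.1 := by
    congr 1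
    funext i
    exact h i i.2
  have := lastII_ofFn a A τ M k
  rw [e, lastII_ofFn, Prod.mk.injEq] at this
  exact ⟨this.1.symm, this.2.symm⟩

/-- A winning strategy of player II is legal for all positions in which player I moves
legally. -/
theorem IIWinning.ruleII {X : Set R} {a : α} {na : ℕ} {A : R} {τ : List R → α × R}
    (hτ : S.IIWinning X a na A τ) (M : ℕ → R) (k : ℕ)
    (h : ∀ i ≤ k, S.ruleI na (playIIa a τ M) (playIIB A τ M) M i) :
    S.ruleII na (playIIa a τ M) (playIIB A τ M) M k := by
  induction k using Nat.strong_induction_on with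
  | _ k ih => exact hτ.1 M k h fun i hi => ih i hi fun j hj => h j (hj.trans hi.le)

/-- If player II has a winning strategy in the game on `[a, A]`, then some `[a, D]` is
disjoint from `X`. -/
theorem IIWinning.exists_disjoint (hTRS : S.IsTRS) (hSel : S.Selective) {X : Set R}
    {a : α} {na : ℕ} {A : R} (hne : (S.seg a na A).Nonempty) {τ : List R → α × R}
    (hτ : S.IIWinning X a na A τ) :
    ∃ D ∈ S.seg a na A, S.seg a na D ∩ X = ∅ := by
  obtain ⟨-, h1, h2, -, -⟩ := id hTRS
  obtain ⟨B, hB⟩ := hne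
  let Good : List R → α → List R → Prop := fun p c q => ∃ E, q = p ++ [E] ∧ (τ q).1 = c ∧
    E ∈ S.seg (lastII a A τ p).1 (na + p.length) (lastII a A τ p).2
  obtain ⟨D₁, hD₁, f, hfa, hf⟩ :=
    exists_settled h1 h2 hSel Good (fun q => (τ q).2) [] a na B hB.2
  obtain ⟨D, hD, hom⟩ := exists_forall_hom hTRS hSel
    {c | Good (f (S.par c)) c (f c) ∧ ∀ Z ∈ S.seg c (S.len c) D₁, S.le Z (τ (f c)).2}
    a na D₁ hD₁.2
  refine ⟨D, ⟨S.le_trans hD.1 (S.le_trans hD₁.1 hB.1), hD.2⟩, ?_⟩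
  rw [Set.eq_empty_iff_forall_notMem]
  rintro Y ⟨hY, hYX⟩
  let p : ℕ → List R := fun k => f (S.r Y (na + k))
  let M : ℕ → R := fun k => (p (k + 1)).getLastD A
  have key : ∀ k, (p k = List.ofFn fun i : Fin k => M i.1) ∧
      playIIa a τ M k = S.r Y (na + k) ∧ S.le Y (playIIB A τ M k) ∧
      ∀ i < k, S.ruleI na (playIIa a τ M) (playIIB A τ M) M i := by
    intro k
    induction k with
    | zero =>
      refine ⟨?_, hY.2.symm, S.le_trans hY.1 (S.le_trans hD.1 (S.le_trans hD₁.1 hB.1)), by simp⟩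
      change f (S.r Y na) = _
      rw [hY.2, hfa]
      simp
    | succ k ih =>
      obtain ⟨hp, ha, hle, hI⟩ := ih
      have hlast : lastII a A τ (p k) = (S.r Y (na + k), playIIB A τ M k) := by
        rw [hp, lastII_ofFn, ha]
      have hlen : (p k).length = k := by rw [hp, List.length_ofFn]
      -- player I may legally answer `p k` with `Y`
      let M' := Function.update M k Y
      have hoff : ∀ i < k, M' i = M i := fun i hi => Function.update_of_ne hi.ne _ _
      have hon : M' k = Y := Function.update_self _ _ _
      have hp' : (List.ofFn fun i : Fin (k + 1) => M' i.1) = p k ++ [Y] := by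
        rw [ofFn_succ_last, hon, hp]
        congr 2
        funext i
        exact hoff i i.2
      have hII : S.ruleII na (playIIa a τ M') (playIIB A τ M') M' k := by
        refine hτ.ruleII M' k fun i hi => ?_
        have hc := play_congr (a := a) (A := A) (τ := τ) (M := M') (M' := M) (k := i)
          fun j hj => hoff j (by omega)
        unfold ruleI
        rw [hc.1, hc.2]
        rcases hi.lt_or_eq with hi | rfl
        · rw [hoff i hi]
          exact hI i hi
        · rw [hon, ha]
          exact ⟨hle, rfl⟩
      obtain ⟨⟨C, hC, hC'⟩, -, hBm⟩ := hII
      have e1 : playIIa a τ M' (k + 1) = (τ (p k ++ [Y])).1 := by rw [← hp']; rfl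
      have e2 : playIIB A τ M' (k + 1) = (τ (p k ++ [Y])).2 := by rw [← hp']; rfl
      rw [(play_congr (A := A) hoff).1, ha] at hC
      rw [e1] at hC' hBm
      rw [e2, hon] at hBm
      generalize hE : (τ (p k ++ [Y])).2 = E at hBm
      have hEb : S.r E (na + k) = S.r Y (na + k) := by
        rw [← hC]
        exact h1.r_eq_of_le (hBm.2.trans hC'.symm) (Nat.le_succ _)
      have hEa : S.r E na = a := by
        rw [h1.r_eq_of_le hEb (Nat.le_add_right _ _), hY.2]
      have hED : S.le E D := S.le_trans hBm.1 hY.1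
      have hED₁ : S.le E D₁ := S.le_trans hED hD.1
      have hgood : Good (p k) (S.r E (na + k + 1)) (p k ++ [Y]) := by
        refine ⟨Y, rfl, hBm.2.symm, ?_⟩
        rw [hlast, hlen]
        exact ⟨hle, rfl⟩
      have hmem : ∀ Z ∈ S.seg (S.r Y (na + k)) (na + k) D,
          Good (f (S.par (S.r Z (na + k + 1)))) (S.r Z (na + k + 1)) (f (S.r Z (na + k + 1))) ∧
          ∀ W ∈ S.seg (S.r Z (na + k + 1)) (S.len (S.r Z (na + k + 1))) D₁,
            S.le W (τ (f (S.r Z (na + k + 1)))).2 := by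
        refine (hom Y hY k).resolve_right fun hno => ?_
        refine hno E ⟨hED, hEb⟩ ?_
        have hs := hf E ⟨hED₁, hEa⟩ k
        rw [hEb] at hs
        refine Or.resolve_right (b := _) ?_ (fun h => ?_ : ¬ ∀ q', Good (p k)
          (S.r E (na + k + 1)) q' →
          (τ q').2 ∉ S.seg (S.r E (na + k + 1)) (S.len (S.r E (na + k + 1))) D₁)
        · change Good _ _ _ ∧ _ ∨ _
          rw [h1.par_r, hEb]
          exact hs
        · refine h _ hgood ?_
          rw [hE, h1.len_r]
          exact ⟨hED₁, rfl⟩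
      obtain ⟨⟨F, hF, hFc, hFm⟩, hT⟩ := hmem Y ⟨hY.1, rfl⟩
      rw [h1.par_r] at hF hFm
      have hF' : p (k + 1) = p k ++ [F] := hF
      have hM : M k = F := by
        change (p (k + 1)).getLastD A = F
        rw [hF']
        simp
      have hpk : p (k + 1) = List.ofFn fun i : Fin (k + 1) => M i.1 := by
        rw [ofFn_succ_last, hM, ← hp, hF']
      have hτp : τ (p (k + 1)) = (playIIa a τ M (k + 1), playIIB A τ M (k + 1)) := by
        rw [hpk]
        rfl
      refine ⟨hpk, ?_, ?_, fun i hi => ?_⟩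
      · have : (τ (p (k + 1))).1 = S.r Y (na + k + 1) := hFc
        rw [hτp] at this
        exact this
      · have : S.le Y (τ (p (k + 1))).2 :=
          hT Y ⟨S.le_trans hY.1 hD.1, by rw [h1.len_r]⟩
        rw [hτp] at this
        exact this
      · rcases Nat.lt_succ_iff_lt_or_eq.1 hi with hi | rfl
        · exact hI i hi
        · have hFm' : F ∈ S.seg (lastII a A τ (p i)).1 (na + (p i).length)
            (lastII a A τ (p i)).2 := hFm
          rw [hlast, hlen] at hFm'
          unfold ruleI
          rw [hM, ha]
          exact hFm'
  have hI : ∀ k, S.ruleI na (playIIa a τ M) (playIIB A τ M) M k := fun k =>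
    (key (k + 1)).2.2.2 k (Nat.lt_succ_self k)
  refine hτ.2 M (fun k => ⟨hI k, hτ.ruleII M k fun i _ => hI i⟩) Y ?_ hYX
  simp only [fun k => (key k).2.1]
  exact h1.iInter_eq_singleton Y na

/-- Objects all of whose approximations come from objects below `B` are below `B`. -/
theorem A2.le_of_approx (h1 : S.A1) (h2 : S.A2) {Y B : R} (na : ℕ)
    (h : ∀ k, ∃ Z, S.le Z B ∧ S.r Z (na + k) = S.r Y (na + k)) : S.le Y B := by
  refine (h2.2.2.2.1 Y B).2 fun n => ?_
  obtain ⟨Z, hZ, e⟩ := h n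
  rw [← h1.r_eq_of_le e (Nat.le_add_left n na)]
  exact h2.hasDepth hZ n

theorem exists_IWinning (h1 : S.A1) (h2 : S.A2) {X : Set R} {a : α} {na : ℕ} {A B : R}
    (hB : B ∈ S.seg a na A) (hX : S.seg a na B ⊆ X) :
    ∃ σ : List (α × R) → R, S.IWinning X a na A σ := by
  let σ : List (α × R) → R := fun l => (l.getLastD (a, B)).2
  have h0 : ∀ ak Bk, playI σ ak Bk 0 = B := fun ak Bk => by simp [playI, σ]
  have hs : ∀ ak Bk k, playI σ ak Bk (k + 1) = Bk (k + 1) := fun ak Bk k => by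
    unfold playI
    rw [ofFn_succ_last fun i => (ak (i + 1), Bk (i + 1))]
    simp [σ]
  refine ⟨σ, ?_, ?_⟩
  · intro ak Bk ha hBk k hII
    unfold ruleI
    cases k with
    | zero =>
      rw [h0, ha, hBk]
      exact hB
    | succ k =>
      rw [hs]
      exact ⟨S.le_refl _, (hII k (Nat.lt_succ_self k)).2.2.2⟩
  · intro ak Bk ha hBk hplay Y hY
    have hYk : ∀ k, S.r Y (na + k) = ak k := by
      have : Y ∈ ⋂ k : ℕ, {Y : R | S.r Y (na + k) = ak k} := hY ▸ Set.mem_singleton Y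
      simpa using this
    have hle : ∀ k, S.le (playI σ ak Bk k) B ∧ S.r (playI σ ak Bk k) (na + k) = ak k := by
      intro k
      refine ⟨?_, (hplay k).1.2⟩
      induction k with
      | zero => rw [h0]; exact S.le_refl B
      | succ k ih =>
        rw [hs]
        exact S.le_trans (hplay k).2.2.2.1 ih
    refine hX ⟨h2.le_of_approx h1 na fun k => ⟨_, (hle k).1, ?_⟩, (hYk 0).trans ha⟩
    rw [(hle k).2, hYk]

theorem exists_IIWinning (h1 : S.A1) (h2 : S.A2) {X : Set R} {a : α} {na : ℕ} {A : R}
    (h : ∀ E ∈ S.seg a na A, ∃ B ∈ S.seg a na E, S.seg a na B ∩ X = ∅) :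
    ∃ τ : List R → α × R, S.IIWinning X a na A τ := by
  classical
  choose! g hg hgX using h
  let τ : List R → α × R := fun l => match l with
    | [] => (a, A)
    | [E] => (S.r (g E) (na + 1), g E)
    | E :: E' :: l => (S.r ((E' :: l).getLastD E) (na + (l.length + 2)), (E' :: l).getLastD E)
  have hτ1 : ∀ M : ℕ → R, τ (List.ofFn fun i : Fin 1 => M i.1) =
      (S.r (g (M 0)) (na + 1), g (M 0)) := fun M => by simp [τ]
  have hτs : ∀ (M : ℕ → R) (k : ℕ), τ (List.ofFn fun i : Fin (k + 2) => M i.1) =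
      (S.r (M (k + 1)) (na + k + 2), M (k + 1)) := by
    intro M k
    have e : (List.ofFn fun i : Fin (k + 2) => M i.1) =
        M 0 :: M 1 :: List.ofFn fun i : Fin k => M (i.1 + 2) := by
      simp [List.ofFn_succ]
    have e' : (M 1 :: List.ofFn fun i : Fin k => M (i.1 + 2)) =
        (List.ofFn fun i : Fin k => M (i.1 + 1)) ++ [M (k + 1)] := by
      rw [← ofFn_succ_last fun i => M (i + 1)]
      simp [List.ofFn_succ]
    have e'' : (M 1 :: List.ofFn fun i : Fin k => M (i.1 + 2)).getLastD (M 0) = M (k + 1) := by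
      rw [e']
      simp
    rw [e]
    change (S.r (List.getLastD (M 1 :: _) (M 0)) _, List.getLastD (M 1 :: _) (M 0)) = _
    rw [e'', List.length_ofFn]
    rfl
  have hII : ∀ (M : ℕ → R) (k : ℕ),
      (∀ i ≤ k, S.ruleI na (playIIa a τ M) (playIIB A τ M) M i) →
      S.ruleII na (playIIa a τ M) (playIIB A τ M) M k := by
    intro M k hI
    -- the answer to a legal move `M k` is `[r_{na+k+1}(B), B]` for some `B ∈ [r_{na+k}(M k), M k]`
    obtain ⟨B, e1, e2, hle, hr⟩ : ∃ B, playIIa a τ M (k + 1) = S.r B (na + k + 1) ∧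
        playIIB A τ M (k + 1) = B ∧ S.le B (M k) ∧ S.r B (na + k) = playIIa a τ M k := by
      have hk := hI k le_rfl
      cases k with
      | zero =>
        refine ⟨g (M 0), congrArg Prod.fst (hτ1 M), congrArg Prod.snd (hτ1 M), ?_, ?_⟩
        · exact (hg _ hk).1
        · exact (hg _ hk).2
      | succ k =>
        exact ⟨M (k + 1), congrArg Prod.fst (hτs M k), congrArg Prod.snd (hτs M k),
          S.le_refl _, hk.2⟩
    refine ⟨⟨B, hr, e1.symm⟩, ?_, ?_⟩
    · rw [e1, ← hr]
      intro e
      have := (h1.2.2 _ _ _ _ e).1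
      omega
    · rw [e1, e2]
      exact ⟨hle, rfl⟩
  refine ⟨τ, fun M k hI _ => hII M k hI, fun M hplay Y hY hYX => ?_⟩
  have hYk : ∀ k, S.r Y (na + k) = playIIa a τ M k := by
    have : Y ∈ ⋂ k : ℕ, {Y : R | S.r Y (na + k) = playIIa a τ M k} := hY ▸ Set.mem_singleton Y
    simpa using this
  have hM0 : M 0 ∈ S.seg a na A := (hplay 0).1
  have hle : ∀ k, S.le (playIIB A τ M (k + 1)) (g (M 0)) := by
    intro k
    induction k with
    | zero =>
      have : playIIB A τ M 1 = g (M 0) := congrArg Prod.snd (hτ1 M)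
      rw [this]
      exact S.le_refl _
    | succ k ih => exact S.le_trans (hplay (k + 1)).2.2.2.1 (S.le_trans (hplay (k + 1)).1.1 ih)
  have hYg : Y ∈ S.seg a na (g (M 0)) := by
    refine ⟨h2.le_of_approx h1 (na + 1) fun k => ⟨_, hle k, ?_⟩, hYk 0⟩
    have e : na + 1 + k = na + (k + 1) := by omega
    rw [e, hYk]
    exact (hplay k).2.2.2.2
  have : Y ∈ S.seg a na (g (M 0)) ∩ X := ⟨hYg, hYX⟩
  rw [hgX _ hM0] at this
  exact this

end Auxiliary

/-- **Abstract Kastanas Theorem.** Let `(ℛ,≤,r)` be a selective topological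
Ramsey space. For every `𝒳 ⊆ ℛ`, `𝒳` is Ramsey iff for every nonempty basic set `[a,A]`
the abstract Kastanas game `𝒢_{[a,A]}(𝒳)` is determined. -/
theorem abstract_kastanas (S : CombStruct R α) (hTRS : S.IsTRS) (hSel : S.Selective)
    (X : Set R) :
    S.RamseySet X ↔
      ∀ (a : α) (na : ℕ) (A : R), a ∈ S.ARn na → (S.seg a na A).Nonempty →
        ((∃ σ : List (α × R) → R, S.IWinning X a na A σ) ∨
         (∃ τ : List R → α × R, S.IIWinning X a na A τ)) := by
  obtain ⟨-, h1, h2, -, -⟩ := id hTRS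
  constructor
  · intro hX a na A ha hne
    by_cases hex : ∃ B ∈ S.seg a na A, S.seg a na B ⊆ X
    · obtain ⟨B, hB, hBX⟩ := hex
      exact Or.inl (exists_IWinning h1 h2 hB hBX)
    · refine Or.inr (exists_IIWinning h1 h2 fun E hE => ?_)
      obtain ⟨B, hB, hBX | hBX⟩ := hX a na E ha ⟨E, S.le_refl E, hE.2⟩
      · exact absurd ⟨B, seg_mono hE.1 _ _ hB, hBX⟩ hex
      · exact ⟨B, hB, hBX⟩
  · intro hdet a na A ha hne
    obtain ⟨σ, hσ⟩ | ⟨τ, hτ⟩ := hdet a na A ha hne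
    · obtain ⟨D, hD, hDX⟩ := hσ.exists_subset h1 h2 hSel
      exact ⟨D, hD, Or.inl hDX⟩
    · obtain ⟨D, hD, hDX⟩ := hτ.exists_disjoint hTRS hSel hne
      exact ⟨D, hD, Or.inr hDX⟩

end CombStruct
end AbstractTRS
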